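/- Let M > N/2 be a positive integer and 0 < β < α be such that 2β + α < π and (M/N) sin(α/2 − β/4) cos(α/2 + 5β/8) − (1 − M/N) cos(α/2 − β/8) > 0. Let μ, λ satisfy 0 < μ ≤ (M/N) sin(α/2 − β/4) cos(α/2 + 5β/8) − (1 − M/N) cos(α/2 − β/8) and λ > μ + 2. Assume mK ≤ β / (4(λ + μ + 2) ln((λ + 2μ + 2)/μ)) and D(Ω) < μK. Let Θ(t) be a solution of the second-order Kuramoto system m θ_i''(t) + θ_i'(t) = ω_i + (K/N) Σ_{j=1}^N sin(θ_j(t) − θ_i(t)) with D(Θ_M(0)) ≤ π − α − β and D(Θ_M'(0)) < λK. Then the full diameter function is uniformly bounded: sup_{t≥0} D(Θ(t)) < ∞. -/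

import Mathlib

open Real Filter

/-- The diameter `D(X) = max_{i≠j} (xᵢ - xⱼ)` of a vector `X ∈ ℝ^N`
(realized as the supremum of `xᵢ - xⱼ` over all pairs). -/
noncomputable def diam {n : ℕ} (X : Fin n → ℝ) : ℝ :=
  ⨆ p : Fin n × Fin n, (X p.1 - X p.2)

/-- Solutions on `[0, ∞)` of the second-order Kuramoto system. -/
def IsInertialKuramoto {N : ℕ} (m K : ℝ) (ω : Fin N → ℝ) (θ : Fin N → ℝ → ℝ) : Prop :=
  (∀ i, ContDiff ℝ 2 (θ i)) ∧ ∀ i, ∀ t : ℝ, 0 ≤ t →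
    m * deriv (deriv (θ i)) t + deriv (θ i) t
      = ω i + K / N * ∑ j, Real.sin (θ j t - θ i t)

namespace IsInertialKuramoto

variable {N : ℕ} {m K : ℝ} {ω : Fin N → ℝ} {θ : Fin N → ℝ → ℝ}

lemma neg (h : IsInertialKuramoto m K ω θ) :
    IsInertialKuramoto m K (fun i => -ω i) (fun i t => -θ i t) := by
  refine ⟨fun i => (h.1 i).neg, fun i t ht => ?_⟩
  have hd : deriv (fun s => -θ i s) = fun s => -deriv (θ i) s := by
    funext s; exact deriv.fun_neg
  have hs : ∑ j, Real.sin (-θ j t - -θ i t) = -∑ j, Real.sin (θ j t - θ i t) := by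
    rw [← Finset.sum_neg_distrib]
    refine Finset.sum_congr rfl fun j _ => ?_
    rw [← Real.sin_neg]; congr 1; ring
  rw [hd, deriv.fun_neg, hs]
  linear_combination -h.2 i t ht

lemma add_int_mul_two_pi (h : IsInertialKuramoto m K ω θ) (n : Fin N → ℤ) :
    IsInertialKuramoto m K ω (fun i t => θ i t + n i * (2 * Real.pi)) := by
  refine ⟨fun i => (h.1 i).add contDiff_const, fun i t ht => ?_⟩
  have hd : deriv (fun s => θ i s + n i * (2 * Real.pi)) = deriv (θ i) := by
    funext s; exact deriv_add_const _
  rw [hd, h.2 i t ht]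
  congr 2
  refine Finset.sum_congr rfl fun j _ => ?_
  rw [← Real.sin_add_int_mul_two_pi (θ j t - θ i t) (n j - n i)]
  congr 1; push_cast; ring

lemma hasDerivAt_sub (h : IsInertialKuramoto m K ω θ) (i j : Fin N) (t : ℝ) :
    HasDerivAt (fun s => θ i s - θ j s) (deriv (θ i) t - deriv (θ j) t) t :=
  (((h.1 i).differentiable (by norm_num)) t).hasDerivAt.sub
    (((h.1 j).differentiable (by norm_num)) t).hasDerivAt

lemma hasDerivAt_deriv_sub (h : IsInertialKuramoto m K ω θ) (i j : Fin N) (t : ℝ) :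
    HasDerivAt (fun s => deriv (θ i) s - deriv (θ j) s)
      (deriv (deriv (θ i)) t - deriv (deriv (θ j)) t) t :=
  ((h.1 i).differentiable_deriv_two t).hasDerivAt.sub
    ((h.1 j).differentiable_deriv_two t).hasDerivAt

/-- Duhamel estimate for a velocity difference under a one-sided bound on the forcing. -/
lemma deriv_sub_le (h : IsInertialKuramoto m K ω θ) (hm : 0 < m) (i j : Fin N) {a b g : ℝ}
    (ha : 0 ≤ a) (hab : a ≤ b)
    (hg : ∀ t ∈ Set.Icc a b, ω i - ω j + K / N * (∑ k, Real.sin (θ k t - θ i t)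
      - ∑ k, Real.sin (θ k t - θ j t)) ≤ g) :
    deriv (θ i) b - deriv (θ j) b
      ≤ g + Real.exp (-((b - a) / m)) * (deriv (θ i) a - deriv (θ j) a - g) := by
  set w : ℝ → ℝ := fun s => deriv (θ i) s - deriv (θ j) s with hw
  have hd : ∀ t, HasDerivAt (fun s => Real.exp (s / m) * (w s - g))
      (Real.exp (t / m) * (1 / m) * (w t - g) + Real.exp (t / m) *
        (deriv (deriv (θ i)) t - deriv (deriv (θ j)) t)) t := fun t =>
    (((hasDerivAt_id t).div_const m).exp).mul ((h.hasDerivAt_deriv_sub i j t).sub_const g)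
  have hanti : AntitoneOn (fun s => Real.exp (s / m) * (w s - g)) (Set.Icc a b) := by
    refine antitoneOn_of_deriv_nonpos (convex_Icc a b)
      (fun t _ => (hd t).continuousAt.continuousWithinAt)
      (fun t _ => (hd t).differentiableAt.differentiableWithinAt) fun t ht => ?_
    rw [interior_Icc] at ht
    have ht' : t ∈ Set.Icc a b := Set.Ioo_subset_Icc_self ht
    have h0 : 0 ≤ t := ha.trans ht'.1
    rw [(hd t).deriv]
    have hF := hg t ht'
    have h1 := h.2 i t h0
    have h2 := h.2 j t h0
    have key : Real.exp (t / m) * (1 / m) * (w t - g) + Real.exp (t / m) *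
        (deriv (deriv (θ i)) t - deriv (deriv (θ j)) t)
        = Real.exp (t / m) * (1 / m) * (w t - g + m *
        (deriv (deriv (θ i)) t - deriv (deriv (θ j)) t)) := by
      field_simp
    rw [key]
    refine mul_nonpos_of_nonneg_of_nonpos (by positivity) ?_
    simp only [hw]
    linarith
  have hle := hanti (Set.left_mem_Icc.2 hab) (Set.right_mem_Icc.2 hab) hab
  have hexp : Real.exp (-((b - a) / m)) = Real.exp (a / m) / Real.exp (b / m) := by
    rw [← Real.exp_sub]; congr 1; ring
  have hb := Real.exp_pos (b / m)
  have hle' : w b - g ≤ Real.exp (a / m) * (w a - g) / Real.exp (b / m) := by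
    rw [le_div_iff₀ hb]; simp only at hle; linarith
  rw [hexp, div_mul_eq_mul_div]
  simp only [hw] at hle' ⊢
  linarith

lemma coupling_sub_le (hN : 0 < N) (hK : 0 ≤ K) (X : Fin N → ℝ) (i j : Fin N) :
    K / N * (∑ k, Real.sin (X k - X i) - ∑ k, Real.sin (X k - X j)) ≤ 2 * K := by
  have hs : ∑ k, Real.sin (X k - X i) - ∑ k, Real.sin (X k - X j) ≤ N * 2 := by
    rw [← Finset.sum_sub_distrib]
    refine (Finset.sum_le_card_nsmul _ _ 2 fun k _ => ?_).trans (by simp)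
    linarith [Real.sin_le_one (X k - X i), Real.neg_one_le_sin (X k - X j)]
  have hN' : (0 : ℝ) < N := by exact_mod_cast hN
  calc _ ≤ K / N * (N * 2) := mul_le_mul_of_nonneg_left hs (by positivity)
    _ = 2 * K := by field_simp

end IsInertialKuramoto

/-- A finite family of functions starting below `L` cannot exceed `L` if, at any time of first
contact, the derivative of the touching function is negative. -/
lemma le_of_deriv_neg_of_first_contact {ι : Type*} [Finite ι] (f f' : ι → ℝ → ℝ) (L t₀ : ℝ)
    (hf : ∀ p t, HasDerivAt (f p) (f' p t) t) (h₀ : ∀ p, f p t₀ < L)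
    (hstep : ∀ p t, t₀ < t → (∀ q, ∀ s ∈ Set.Icc t₀ t, f q s ≤ L) → f p t = L → f' p t < 0) :
    ∀ t, t₀ ≤ t → ∀ p, f p t ≤ L := by
  by_contra! hcon
  obtain ⟨t₁, ht₁, p₁, hp₁⟩ := hcon
  have hcont : ∀ p, Continuous (f p) := fun p =>
    continuous_iff_continuousAt.2 fun t => (hf p t).continuousAt
  set S : Set ℝ := Set.Ici t₀ ∩ ⋃ p, {t | L ≤ f p t} with hS
  have hSc : IsClosed S := isClosed_Ici.inter
    (isClosed_iUnion_of_finite fun p => isClosed_le continuous_const (hcont p))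
  have hSne : S.Nonempty := ⟨t₁, ht₁, Set.mem_iUnion.2 ⟨p₁, hp₁.le⟩⟩
  have hSb : BddBelow S := ⟨t₀, fun t ht => ht.1⟩
  obtain ⟨hτ₀, hτ⟩ := hSc.csInf_mem hSne hSb
  set τ := sInf S with hτdef
  obtain ⟨p, hp⟩ := Set.mem_iUnion.1 hτ
  have hlt : ∀ s, t₀ ≤ s → s < τ → ∀ q, f q s < L := by
    intro s hs hsτ q
    by_contra! hc
    exact absurd (csInf_le hSb ⟨hs, Set.mem_iUnion.2 ⟨q, hc⟩⟩) (not_le.2 hsτ)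
  have hτlt : t₀ < τ := lt_of_le_of_ne hτ₀ fun he => by
    have := h₀ p
    rw [he] at this
    exact absurd hp (not_le.2 this)
  have hev : ∀ᶠ s in nhdsWithin τ (Set.Iio τ), t₀ < s ∧ s < τ := by
    filter_upwards [Ioo_mem_nhdsLT hτlt] with s hs using hs
  have hleτ : ∀ q, f q τ ≤ L := fun q =>
    le_of_tendsto ((hcont q).continuousAt.tendsto.mono_left nhdsWithin_le_nhds)
      (hev.mono fun s hs => (hlt s hs.1.le hs.2 q).le)
  have heq : f p τ = L := le_antisymm (hleτ p) hp
  have hneg := hstep p τ hτlt (fun q s hs => by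
    rcases hs.2.lt_or_eq with h | h
    · exact (hlt s hs.1 h q).le
    · rw [h]; exact hleτ q) heq
  have hslope := (hasDerivAt_iff_tendsto_slope.1 (hf p τ)).mono_left
    (nhdsWithin_mono τ (show Set.Iio τ ⊆ {τ}ᶜ from fun s hs => ne_of_lt hs))
  refine absurd (ge_of_tendsto hslope (hev.mono fun s hs => ?_)) (not_le.2 hneg)
  rw [slope_def_field]
  exact div_nonneg_of_nonpos (by linarith [hlt s hs.1.le hs.2 p]) (by linarith [hs.2])

lemma sum_cos_lower_bound {N M : ℕ} (hMN : M ≤ N) (Y : Fin N → ℝ) (c : ℝ)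
    (hc : ∀ l : Fin M, c ≤ Real.cos (Y (Fin.castLE hMN l))) :
    M * c - (N - M) ≤ ∑ k, Real.cos (Y k) := by
  have hsub : ∑ l : Fin M, (Real.cos (Y (Fin.castLE hMN l)) + 1)
      ≤ ∑ k, (Real.cos (Y k) + 1) := by
    refine (Finset.sum_map Finset.univ (Fin.castLEEmb hMN)
      (fun k => Real.cos (Y k) + 1)).symm.trans_le ?_
    exact Finset.sum_le_sum_of_subset_of_nonneg (Finset.subset_univ _)
      fun k _ _ => by linarith [Real.neg_one_le_cos (Y k)]
  have hM : (M : ℝ) * (c + 1) ≤ ∑ l : Fin M, (Real.cos (Y (Fin.castLE hMN l)) + 1) := by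
    refine le_trans (by simp [mul_add]) (Finset.card_nsmul_le_sum Finset.univ _ (c + 1)
      fun l _ => by linarith [hc l])
  have hN : ∑ k, (Real.cos (Y k) + 1) = ∑ k, Real.cos (Y k) + N := by
    simp [Finset.sum_add_distrib]
  linarith

/-- When two oscillators are nearly `π - α` apart and the majority cluster lies within `π - α` of
both extremes, the coupling pulls them together. -/
lemma coupling_sub_le_of_near_extremal {N M : ℕ} (hM0 : 0 < M) (hMN : M ≤ N) {K α β μ : ℝ}
    (hK : 0 < K) (hβ : 0 < β) (hβα : β < α) (hαβπ : 2 * β + α < Real.pi)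
    (hμ : μ ≤ (M : ℝ) / N * Real.sin (α / 2 - β / 4) * Real.cos (α / 2 + 5 / 8 * β)
        - (1 - (M : ℝ) / N) * Real.cos (α / 2 - β / 8))
    (X : Fin N → ℝ) (i j : Fin N)
    (hlo : Real.pi - α - β / 4 ≤ X i - X j) (hhi : X i - X j ≤ Real.pi - α)
    (hcl : ∀ l : Fin M, X (Fin.castLE hMN l) - X j ≤ Real.pi - α ∧
      X i - X (Fin.castLE hMN l) ≤ Real.pi - α) :
    K / N * (∑ k, Real.sin (X k - X i) - ∑ k, Real.sin (X k - X j)) ≤ -(2 * μ * K) := by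
  have hN : (0 : ℝ) < N := by exact_mod_cast hM0.trans_le hMN
  have hMN' : (M : ℝ) ≤ N := by exact_mod_cast hMN
  have hM : (0 : ℝ) < M := by exact_mod_cast hM0
  set p := (X i + X j) / 2 with hp
  set S := Real.sin ((X i - X j) / 2) with hS
  have hsum : ∑ k, Real.sin (X k - X i) - ∑ k, Real.sin (X k - X j)
      = -(2 * S * ∑ k, Real.cos (X k - p)) := by
    rw [← Finset.sum_sub_distrib, Finset.mul_sum, ← Finset.sum_neg_distrib]
    refine Finset.sum_congr rfl fun k _ => ?_
    rw [Real.sin_sub_sin, show (X k - X i - (X k - X j)) / 2 = -((X i - X j) / 2) by ring,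
      show (X k - X i + (X k - X j)) / 2 = X k - p by rw [hp]; ring, Real.sin_neg]
    ring
  have hcos : ∀ l : Fin M,
      Real.sin (α / 2 - β / 4) ≤ Real.cos (X (Fin.castLE hMN l) - p) := by
    intro l
    obtain ⟨h1, h2⟩ := hcl l
    rw [← Real.cos_pi_div_two_sub, ← Real.cos_abs (X (Fin.castLE hMN l) - p)]
    refine Real.cos_le_cos_of_nonneg_of_le_pi (abs_nonneg _) (by linarith) ?_
    rw [abs_le]
    constructor <;> linarith
  have hsumcos := sum_cos_lower_bound hMN (fun k => X k - p) _ hcos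
  have hS1 : Real.cos (α / 2 + 5 / 8 * β) ≤ S := by
    rw [← Real.sin_pi_div_two_sub]
    exact Real.sin_le_sin_of_le_of_le_pi_div_two (by linarith) (by linarith) (by linarith)
  have hS2 : S ≤ Real.cos (α / 2 - β / 8) := by
    rw [← Real.sin_pi_div_two_sub]
    exact Real.sin_le_sin_of_le_of_le_pi_div_two (by linarith) (by linarith) (by linarith)
  have hS0 : 0 ≤ S := Real.sin_nonneg_of_nonneg_of_le_pi (by linarith) (by linarith)
  have hsin0 : 0 ≤ Real.sin (α / 2 - β / 4) :=
    Real.sin_nonneg_of_nonneg_of_le_pi (by linarith) (by linarith)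
  have hkey : μ * N ≤ S * ∑ k, Real.cos (X k - p) := by
    have e : ((M : ℝ) / N * Real.sin (α / 2 - β / 4) * Real.cos (α / 2 + 5 / 8 * β)
        - (1 - (M : ℝ) / N) * Real.cos (α / 2 - β / 8)) * N
        = M * Real.sin (α / 2 - β / 4) * Real.cos (α / 2 + 5 / 8 * β)
          - (N - M) * Real.cos (α / 2 - β / 8) := by
      field_simp
    have a1 := mul_le_mul_of_nonneg_right hμ hN.le
    rw [e] at a1
    have a2 := mul_le_mul_of_nonneg_left hS1 (mul_nonneg hM.le hsin0)
    have a3 := mul_le_mul_of_nonneg_left hS2 (sub_nonneg.2 hMN')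
    have a4 := mul_le_mul_of_nonneg_left hsumcos hS0
    linarith
  have hKN := mul_le_mul_of_nonneg_left hkey (show 0 ≤ 2 * (K / N) by positivity)
  have e2 : 2 * (K / N) * (μ * N) = 2 * μ * K := by field_simp
  rw [hsum]
  linarith

/-- The two consequences of the small-inertia assumption: over the relaxation window
`m log ((lam + 2μ + 2) / μ)` positions move by at most `β / 4`, and velocities bounded by `lam K`
turn negative under a forcing below `-μ K`. -/
lemma relaxation_window {m K β μ lam : ℝ} (hm : 0 < m) (hK : 0 < K) (hμ0 : 0 < μ)
    (hlam : lam > μ + 2)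
    (hmK : m * K ≤ β / (4 * (lam + μ + 2) * Real.log ((lam + 2 * μ + 2) / μ))) :
    ∃ δ, 0 < δ ∧ lam * K * δ ≤ β / 4 ∧
      -(μ * K) + Real.exp (-(δ / m)) * (lam * K + μ * K) < 0 := by
  have hr : 1 < (lam + 2 * μ + 2) / μ := by rw [lt_div_iff₀ hμ0]; linarith
  have hlog := Real.log_pos hr
  refine ⟨m * Real.log ((lam + 2 * μ + 2) / μ), by positivity, ?_, ?_⟩
  · have hpos : 0 < lam + μ + 2 := by linarith
    rw [le_div_iff₀ (by positivity)] at hmK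
    have : 0 ≤ (μ + 2) * (m * K * Real.log ((lam + 2 * μ + 2) / μ)) := by positivity
    linarith
  · rw [mul_div_cancel_left₀ _ hm.ne', Real.exp_neg, Real.exp_log (by linarith), inv_div]
    have hpos : 0 < lam + 2 * μ + 2 := by linarith
    have e : -(μ * K) + μ / (lam + 2 * μ + 2) * (lam * K + μ * K)
        = -(μ * K * (μ + 2) / (lam + 2 * μ + 2)) := by
      have hne := hpos.ne'
      generalize hD : lam + 2 * μ + 2 = D at hne
      obtain rfl : lam = D - 2 * μ - 2 := by linarith
      field_simp
      ring
    rw [e, neg_lt_zero]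
    positivity

/-- Trapping: a family of phase differences with controlled speed, starting `β` below `L`, stays
below `L` when the forcing is at most `-μ K` near `L`. -/
lemma IsInertialKuramoto.phase_diff_le {N : ℕ} {m K : ℝ} {ω : Fin N → ℝ} {θ : Fin N → ℝ → ℝ}
    (h : IsInertialKuramoto m K ω θ) (hm : 0 < m) (hK : 0 < K) {β μ lam δ L t₀ : ℝ}
    (hβ : 0 < β) (hlam : 0 < lam) (hδ : 0 < δ) (hδβ : lam * K * δ ≤ β / 4)
    (hdec : -(μ * K) + Real.exp (-(δ / m)) * (lam * K + μ * K) < 0) (ht₀ : 0 ≤ t₀)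
    {ι : Type*} [Finite ι] (i j : ι → Fin N)
    (hvel : ∀ p, ∀ t, t₀ ≤ t → deriv (θ (i p)) t - deriv (θ (j p)) t ≤ lam * K)
    (hinit : ∀ p, θ (i p) t₀ - θ (j p) t₀ ≤ L - β)
    (hforce : ∀ t, t₀ ≤ t → (∀ q, θ (i q) t - θ (j q) t ≤ L) → ∀ p,
      L - β / 4 ≤ θ (i p) t - θ (j p) t →
      ω (i p) - ω (j p) + K / N * (∑ k, Real.sin (θ k t - θ (i p) t)
        - ∑ k, Real.sin (θ k t - θ (j p) t)) ≤ -(μ * K)) :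
    ∀ t, t₀ ≤ t → ∀ p, θ (i p) t - θ (j p) t ≤ L := by
  refine le_of_deriv_neg_of_first_contact (fun p t => θ (i p) t - θ (j p) t)
    (fun p t => deriv (θ (i p)) t - deriv (θ (j p)) t) L t₀
    (fun p t => h.hasDerivAt_sub (i p) (j p) t)
    (fun p => (hinit p).trans_lt (by linarith)) fun p t ht hle heq => ?_
  have hmove : ∀ s, t₀ ≤ s → s ≤ t →
      L - (θ (i p) s - θ (j p) s) ≤ lam * K * (t - s) := by
    intro s hs hst
    have := (convex_Ici t₀).image_sub_le_mul_sub_of_deriv_le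
      (f := fun s => θ (i p) s - θ (j p) s)
      (fun r _ => (h.hasDerivAt_sub (i p) (j p) r).continuousAt.continuousWithinAt)
      (fun r _ => (h.hasDerivAt_sub (i p) (j p) r).differentiableAt.differentiableWithinAt)
      (C := lam * K) (fun r hr => by
        rw [(h.hasDerivAt_sub (i p) (j p) r).deriv]
        exact hvel p r (interior_subset hr)) s hs t ht.le hst
    linarith
  have hlK : 0 < lam * K := by positivity
  have ha : t₀ ≤ t - δ := by
    have h1 := hmove t₀ le_rfl ht.le
    have h2 : lam * K * δ ≤ lam * K * (t - t₀) := by linarith [hinit p]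
    linarith [le_of_mul_le_mul_left h2 hlK]
  have hb := h.deriv_sub_le hm (i p) (j p) (a := t - δ) (b := t) (g := -(μ * K))
    (ht₀.trans ha) (by linarith) fun s hs => by
      refine hforce s (ha.trans hs.1) (fun q => hle q s ⟨ha.trans hs.1, hs.2⟩) p ?_
      have h1 := hmove s (ha.trans hs.1) hs.2
      have h2 : lam * K * (t - s) ≤ lam * K * δ :=
        mul_le_mul_of_nonneg_left (by linarith [hs.1]) hlK.le
      linarith
  rw [sub_sub_cancel] at hb
  have hv := mul_le_mul_of_nonneg_left (hvel p _ ha) (Real.exp_pos (-(δ / m))).le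
  linarith

lemma sub_le_diam {n : ℕ} (X : Fin n → ℝ) (i j : Fin n) : X i - X j ≤ diam X :=
  le_ciSup (f := fun p : Fin n × Fin n => X p.1 - X p.2) (Set.finite_range _).bddAbove (i, j)

/-- Velocity differences stay below any threshold exceeding the maximal forcing once they are. -/
lemma IsInertialKuramoto.deriv_sub_le_add {N : ℕ} {m K : ℝ} {ω : Fin N → ℝ} {θ : Fin N → ℝ → ℝ}
    (h : IsInertialKuramoto m K ω θ) (hm : 0 < m) (hK : 0 < K) {μ : ℝ} (i j : Fin N)
    (hω : ω i - ω j ≤ μ * K) {t : ℝ} (ht : 0 ≤ t) :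
    deriv (θ i) t - deriv (θ j) t ≤ (μ + 2) * K
      + Real.exp (-(t / m)) * (deriv (θ i) 0 - deriv (θ j) 0 - (μ + 2) * K) := by
  have := h.deriv_sub_le hm i j (a := 0) (b := t) (g := (μ + 2) * K) le_rfl ht fun s _ => by
    linarith [coupling_sub_le i.pos hK.le (fun k => θ k s) i j]
  rwa [sub_zero] at this

/-- An oscillator cannot rotate upwards past a trapped majority cluster indefinitely. -/
lemma IsInertialKuramoto.exists_phase_diff_le {N M : ℕ} (hM0 : 0 < M) (hMN : M ≤ N)
    {m K α β μ lam δ : ℝ} (hm : 0 < m) (hK : 0 < K)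
    (hβ : 0 < β) (hβα : β < α) (hαβπ : 2 * β + α < Real.pi) (hμ0 : 0 < μ)
    (hμ : μ ≤ (M : ℝ) / N * Real.sin (α / 2 - β / 4) * Real.cos (α / 2 + 5 / 8 * β)
        - (1 - (M : ℝ) / N) * Real.cos (α / 2 - β / 8))
    (hlam : lam > μ + 2) (hδ : 0 < δ) (hδβ : lam * K * δ ≤ β / 4)
    (hdec : -(μ * K) + Real.exp (-(δ / m)) * (lam * K + μ * K) < 0)
    {ω : Fin N → ℝ} {θ : Fin N → ℝ → ℝ} (h : IsInertialKuramoto m K ω θ)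
    (hω : ∀ i j, ω i - ω j ≤ μ * K)
    (htrap : ∀ t, 0 ≤ t → ∀ l l' : Fin M,
      θ (Fin.castLE hMN l) t - θ (Fin.castLE hMN l') t ≤ Real.pi - α)
    (k : Fin N) (j : Fin M) :
    ∃ C, ∀ t, 0 ≤ t → θ k t - θ (Fin.castLE hMN j) t ≤ C := by
  by_cases hk : ∃ l : Fin M, Fin.castLE hMN l = k
  · obtain ⟨l, rfl⟩ := hk
    exact ⟨_, fun t ht => htrap t ht l j⟩
  push Not at hk
  have hev : ∀ᶠ t in Filter.atTop, ∀ l : Fin M,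
      deriv (θ k) t - deriv (θ (Fin.castLE hMN l)) t ≤ lam * K := by
    refine Filter.eventually_all.2 fun l => ?_
    have hlim : Filter.Tendsto (fun t : ℝ => (μ + 2) * K + Real.exp (-(t / m)) *
        (deriv (θ k) 0 - deriv (θ (Fin.castLE hMN l)) 0 - (μ + 2) * K)) Filter.atTop
        (nhds ((μ + 2) * K + 0 *
          (deriv (θ k) 0 - deriv (θ (Fin.castLE hMN l)) 0 - (μ + 2) * K))) :=
      ((Real.tendsto_exp_neg_atTop_nhds_zero.comp
        (Filter.tendsto_id.atTop_div_const hm)).mul_const _).const_add _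
    have hlt : (μ + 2) * K + 0 *
        (deriv (θ k) 0 - deriv (θ (Fin.castLE hMN l)) 0 - (μ + 2) * K) < lam * K := by
      rw [zero_mul, add_zero]; exact mul_lt_mul_of_pos_right hlam hK
    filter_upwards [hlim.eventually_lt_const hlt, Filter.eventually_ge_atTop 0] with t h1 h2
    exact (h.deriv_sub_le_add hm hK _ _ (hω _ _) h2).trans h1.le
  obtain ⟨T, hT⟩ := Filter.eventually_atTop.1 (hev.and (Filter.eventually_ge_atTop 0))
  have hT0 : 0 ≤ T := (hT T le_rfl).2
  obtain ⟨n, hn⟩ : ∃ n : ℕ, ∀ l : Fin M,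
      θ k T - θ (Fin.castLE hMN l) T - n * (2 * Real.pi) ≤ Real.pi - α - β := by
    have : ∀ᶠ n : ℕ in Filter.atTop, ∀ l : Fin M,
        θ k T - θ (Fin.castLE hMN l) T - (Real.pi - α - β) ≤ n * (2 * Real.pi) :=
      Filter.eventually_all.2 fun l =>
        (tendsto_natCast_atTop_atTop.atTop_mul_const Real.two_pi_pos).eventually_ge_atTop _
    obtain ⟨n, hn⟩ := this.exists
    exact ⟨n, fun l => by linarith [hn l]⟩
  set ψ : Fin N → ℝ → ℝ :=
    fun i t => θ i t + ((if i = k then -(n : ℤ) else 0 : ℤ) : ℝ) * (2 * Real.pi) with hψ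
  have hsol : IsInertialKuramoto m K ω ψ := h.add_int_mul_two_pi fun i => if i = k then -n else 0
  have hψk : ∀ t, ψ k t = θ k t - n * (2 * Real.pi) := fun t => by simp [hψ]; ring
  have hψl : ∀ (l : Fin M) t, ψ (Fin.castLE hMN l) t = θ (Fin.castLE hMN l) t :=
    fun l t => by simp [hψ, hk l]
  have hψ' : ∀ i, deriv (ψ i) = deriv (θ i) := fun i => by
    funext s; exact deriv_add_const _
  have hbound := hsol.phase_diff_le hm hK (L := Real.pi - α) (t₀ := T) hβ (by linarith) hδ hδβ
    hdec hT0 (fun _ : Fin M => k) (fun l => Fin.castLE hMN l)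
    (fun l t ht => by rw [hψ', hψ']; exact (hT t ht).1 l)
    (fun l => by rw [hψk, hψl]; linarith [hn l])
    (fun t ht hle l hlo => by
      have := coupling_sub_le_of_near_extremal hM0 hMN hK hβ hβα hαβπ hμ (fun i => ψ i t) k
        (Fin.castLE hMN l) hlo (hle l) fun l' =>
          ⟨by simp only [hψl]; exact htrap t (hT0.trans ht) l' l, hle l'⟩
      linarith [hω k (Fin.castLE hMN l)])
  have hcont : Continuous fun t => θ k t - θ (Fin.castLE hMN j) t :=
    (h.1 _).continuous.sub (h.1 _).continuous
  obtain ⟨B, hB⟩ := (isCompact_Icc (a := (0 : ℝ)) (b := T)).bddAbove_image hcont.continuousOn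
  refine ⟨max B (Real.pi - α + n * (2 * Real.pi)), fun t ht => ?_⟩
  rcases le_total t T with htT | htT
  · exact (hB ⟨t, ⟨ht, htT⟩, rfl⟩).trans (le_max_left _ _)
  · have := hbound t htT j
    rw [hψk, hψl] at this
    exact le_trans (by linarith) (le_max_right _ _)

/-- Lemma 2.8: under the sector trapping hypotheses, the full diameter function
`D(Θ(t))` is uniformly bounded. -/
theorem kuramoto_full_diameter_bounded
    (N M : ℕ) (hM0 : 0 < M) (hM : N < 2 * M) (hMN : M ≤ N)
    (m K : ℝ) (hm : 0 < m) (hK : 0 < K)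
    (α β μ lam : ℝ)
    (hβ : 0 < β) (hβα : β < α) (hαβπ : 2 * β + α < Real.pi)
    (hpos : 0 < (M : ℝ) / N * Real.sin (α / 2 - β / 4) * Real.cos (α / 2 + 5 / 8 * β)
        - (1 - (M : ℝ) / N) * Real.cos (α / 2 - β / 8))
    (hμ0 : 0 < μ)
    (hμ : μ ≤ (M : ℝ) / N * Real.sin (α / 2 - β / 4) * Real.cos (α / 2 + 5 / 8 * β)
        - (1 - (M : ℝ) / N) * Real.cos (α / 2 - β / 8))
    (hlam : lam > μ + 2)
    (hmK : m * K ≤ β / (4 * (lam + μ + 2) * Real.log ((lam + 2 * μ + 2) / μ)))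
    (ω : Fin N → ℝ) (hΩ : diam ω < μ * K)
    (θ : Fin N → ℝ → ℝ)
    (hsmooth : ∀ i, ContDiff ℝ 2 (θ i))
    (hode : ∀ i, ∀ t : ℝ, 0 ≤ t →
      m * deriv (deriv (θ i)) t + deriv (θ i) t
        = ω i + K / N * ∑ j, Real.sin (θ j t - θ i t))
    (hinit : diam (fun i : Fin M => θ (Fin.castLE hMN i) 0) ≤ Real.pi - α - β)
    (hinit' : diam (fun i : Fin M => deriv (θ (Fin.castLE hMN i)) 0) < lam * K) :
    ∃ C : ℝ, ∀ t : ℝ, 0 ≤ t → diam (fun i => θ i t) ≤ C := by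
  have h : IsInertialKuramoto m K ω θ := ⟨hsmooth, hode⟩
  obtain ⟨δ, hδ, hδβ, hdec⟩ := relaxation_window hm hK hμ0 hlam hmK
  have hω : ∀ i j, ω i - ω j ≤ μ * K := fun i j => (sub_le_diam ω i j).trans hΩ.le
  have hvel : ∀ l l' : Fin M, ∀ t, 0 ≤ t →
      deriv (θ (Fin.castLE hMN l)) t - deriv (θ (Fin.castLE hMN l')) t ≤ lam * K := by
    intro l l' t ht
    have h1 := h.deriv_sub_le_add hm hK _ _ (hω (Fin.castLE hMN l) (Fin.castLE hMN l')) ht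
    have h0 := (sub_le_diam (fun i : Fin M => deriv (θ (Fin.castLE hMN i)) 0) l l').trans hinit'.le
    have he0 := (Real.exp_pos (-(t / m))).le
    have he1 : Real.exp (-(t / m)) ≤ 1 :=
      Real.exp_le_one_iff.2 (neg_nonpos.2 (div_nonneg ht hm.le))
    have hlt : (μ + 2) * K ≤ lam * K := mul_le_mul_of_nonneg_right hlam.le hK.le
    have h2 := mul_le_mul_of_nonneg_left (sub_le_sub_right h0 ((μ + 2) * K)) he0
    have h3 := mul_le_mul_of_nonneg_right he1 (sub_nonneg.2 hlt)
    linarith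
  have htrap : ∀ t, 0 ≤ t → ∀ l l' : Fin M,
      θ (Fin.castLE hMN l) t - θ (Fin.castLE hMN l') t ≤ Real.pi - α := by
    have hbound := h.phase_diff_le hm hK (L := Real.pi - α) (t₀ := 0) hβ (by linarith) hδ hδβ
      hdec le_rfl (fun p : Fin M × Fin M => Fin.castLE hMN p.1) (fun p => Fin.castLE hMN p.2)
      (fun p t ht => hvel p.1 p.2 t ht)
      (fun p => (sub_le_diam (fun i : Fin M => θ (Fin.castLE hMN i) 0) p.1 p.2).trans hinit)
      (fun t _ hle p hlo => by
        have := coupling_sub_le_of_near_extremal hM0 hMN hK hβ hβα hαβπ hμ (fun i => θ i t)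
          (Fin.castLE hMN p.1) (Fin.castLE hMN p.2) hlo (hle p) fun l =>
            ⟨hle (l, p.2), hle (p.1, l)⟩
        linarith [hω (Fin.castLE hMN p.1) (Fin.castLE hMN p.2)])
    exact fun t ht l l' => hbound t ht (l, l')
  choose A hA using fun k => h.exists_phase_diff_le hM0 hMN hm hK hβ hβα hαβπ hμ0 hμ hlam hδ hδβ
    hdec hω htrap k ⟨0, hM0⟩
  choose B hB using fun k => h.neg.exists_phase_diff_le hM0 hMN hm hK hβ hβα hαβπ hμ0 hμ hlam hδ
    hδβ hdec (fun i j => by linarith [hω j i]) (fun t ht l l' => by linarith [htrap t ht l' l])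
    k ⟨0, hM0⟩
  refine ⟨⨆ p : Fin N × Fin N, (A p.1 + B p.2), fun t ht =>
    ciSup_mono (Set.finite_range _).bddAbove fun p => ?_⟩
  linarith [hA p.1 t ht, hB p.2 t ht]
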